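/- Let P(a,z) = z³ − 3z − 2cos a as a smooth real function on ℝ². Then: (i) the set of points (a,z) with a ∈ [0,2π) satisfying P = 0, ∂P/∂a = 0 and ∂P/∂z = 0 is exactly {(0,−1), (π,1)}; (ii) the Hessian matrix of P at any (a,z) is diag(2cos a, 6z); (iii) at both points (0,−1) and (π,1) the Hessian has determinant −12 and exactly one positive and one negative eigenvalue, so both points are Dirac points. -/

import Mathlib

open Real Polynomial Matrix

/-- The characteristic polynomial of the triangle-graph (single bond) Harper
Hamiltonian, as a smooth real function of `(a, z)`. -/
noncomputable def P (a z : ℝ) : ℝ := z ^ 3 - 3 * z - 2 * Real.cos a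

/-- Partial derivative in the first variable. -/
noncomputable def pda (f : ℝ → ℝ → ℝ) (a z : ℝ) : ℝ :=
  deriv (fun t => f t z) a

/-- Partial derivative in the second variable. -/
noncomputable def pdz (f : ℝ → ℝ → ℝ) (a z : ℝ) : ℝ :=
  deriv (fun t => f a t) z

/-- The Hessian matrix of `P` in the variables `(a, z)`, in this order. -/
noncomputable def hessP (a z : ℝ) : Matrix (Fin 2) (Fin 2) ℝ :=
  !![pda (pda P) a z, pdz (pda P) a z;
     pda (pdz P) a z, pdz (pdz P) a z]

theorem pda_P (a z : ℝ) : pda P a z = 2 * Real.sin a := by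
  simp [pda, P]

theorem pdz_P (a z : ℝ) : pdz P a z = 3 * z ^ 2 - 3 := by
  have h : HasDerivAt (fun t : ℝ => t ^ 3 - 3 * t - 2 * Real.cos a) (3 * z ^ 2 - 3) z := by
    simpa using (((hasDerivAt_id z).pow 3).sub ((hasDerivAt_id z).const_mul 3)).sub_const
      (2 * Real.cos a)
  exact h.deriv

theorem hessP_eq (a z : ℝ) : hessP a z = !![2 * Real.cos a, 0; 0, 6 * z] := by
  have h₁ : pda P = fun a _ => 2 * Real.sin a := by
    ext a z
    exact pda_P a z
  have h₂ : pdz P = fun _ z => 3 * z ^ 2 - 3 := by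
    ext a z
    exact pdz_P a z
  have h₃ : (3 : ℝ) * (2 * z) = 6 * z := by ring
  rw [hessP, h₁, h₂]
  simp [pda, pdz, h₃]

theorem sin_eq_zero_iff_of_mem_Ico {a : ℝ} (ha : a ∈ Set.Ico 0 (2 * π)) :
    Real.sin a = 0 ↔ a = 0 ∨ a = π := by
  refine ⟨fun h => ?_, ?_⟩
  · rcases lt_or_ge a π with hlt | hge
    · exact Or.inl ((Real.sin_eq_zero_iff_of_lt_of_lt (by linarith [ha.1, Real.pi_pos]) hlt).1 h)
    · have h' : Real.sin (a - π) = 0 := by rw [Real.sin_sub_pi, h, neg_zero]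
      have := (Real.sin_eq_zero_iff_of_lt_of_lt (by linarith [Real.pi_pos])
        (by linarith [ha.2])).1 h'
      exact Or.inr (by linarith)
  · rintro (rfl | rfl) <;> simp

theorem critical_zero_iff (a z : ℝ) :
    (a ∈ Set.Ico 0 (2 * π) ∧ P a z = 0 ∧ pda P a z = 0 ∧ pdz P a z = 0) ↔
      (a = 0 ∧ z = -1) ∨ (a = π ∧ z = 1) := by
  rw [pda_P, pdz_P]
  constructor
  · rintro ⟨ha, hP, hs, hz⟩
    have hz' : z = 1 ∨ z = -1 := by
      rw [← sq_eq_sq_iff_eq_or_eq_neg]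
      linarith
    rcases (sin_eq_zero_iff_of_mem_Ico ha).1 (by linarith) with rfl | rfl <;>
      rcases hz' with rfl | rfl
    · norm_num [P] at hP
    · simp
    · simp
    · norm_num [P] at hP
  · have := Real.pi_pos
    rintro (⟨rfl, rfl⟩ | ⟨rfl, rfl⟩)
    · norm_num [P, this]
    · refine ⟨⟨this.le, by linarith⟩, ?_⟩
      norm_num [P]

theorem charpoly_diag_two {R : Type*} [CommRing R] (x y : R) :
    (!![x, 0; 0, y] : Matrix (Fin 2) (Fin 2) R).charpoly = (X - C x) * (X - C y) := by
  simp [Matrix.charpoly, Matrix.det_fin_two]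

theorem triangle_dirac_points :
    ({p : ℝ × ℝ |
        p.1 ∈ Set.Ico 0 (2 * π) ∧
        P p.1 p.2 = 0 ∧ pda P p.1 p.2 = 0 ∧ pdz P p.1 p.2 = 0} =
      {((0 : ℝ), (-1 : ℝ)), (π, (1 : ℝ))}) ∧
    (∀ a z : ℝ, hessP a z = !![2 * Real.cos a, 0; 0, 6 * z]) ∧
    ((hessP 0 (-1)).det = -12 ∧
      (hessP 0 (-1)).charpoly = (X - 2) * (X + 6)) ∧
    ((hessP π 1).det = -12 ∧
      (hessP π 1).charpoly = (X + 2) * (X - 6)) := by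
  refine ⟨?_, hessP_eq, ⟨?_, ?_⟩, ?_, ?_⟩
  · ext ⟨a, z⟩
    simpa using critical_zero_iff a z
  · norm_num [hessP_eq, Matrix.det_fin_two]
  · rw [hessP_eq, charpoly_diag_two]
    norm_num [map_ofNat (C : ℝ →+* ℝ[X])]
  · norm_num [hessP_eq, Matrix.det_fin_two]
  · rw [hessP_eq, charpoly_diag_two]
    norm_num [map_ofNat (C : ℝ →+* ℝ[X])]
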